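/- Let n, m ≥ 1. Let A : [0,∞) → ℝ^{n×n} and C : [0,∞) → ℝ^{m×n} be continuous and bounded, let V : [0,∞) → ℝ^{n×n} and Q : [0,∞) → ℝ^{m×m} be continuous, bounded, symmetric-valued and uniformly positive definite, and let Φ be a state transition matrix for A. Assume there exist constants δ, μ_v, μ_q > 0 such that for all t ≥ 0: (1/δ) ∫_t^{t+δ} Φ(t+δ, τ) V(τ) Φ(t+δ, τ)ᵀ dτ ⪰ μ_v I_n and (1/δ) ∫_t^{t+δ} Φ(τ, t)ᵀ C(τ)ᵀ Q(τ) C(τ) Φ(τ, t) dτ ⪰ μ_q I_n. Then any differentiable symmetric-matrix-valued solution P : [0,∞) → ℝ^{n×n} of the continuous Riccati equation Ṗ(t) = A(t) P(t) + P(t) A(t)ᵀ − P(t) C(t)ᵀ Q(t) C(t) P(t) + V(t) with P(0) symmetric positive definite satisfies: there exist constants 0 < p_m ≤ p_M < ∞ such that p_m I_n ⪯ P(t) ⪯ p_M I_n for all t ≥ 0. -/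

import Mathlib

open Matrix Set Filter Topology

section MatrixCalculus

open scoped Matrix.Norms.Elementwise

variable {l m n : Type*} [Fintype n]

theorem hasDerivWithinAt_matrix_iff {M : ℝ → Matrix m n ℝ} {M' : Matrix m n ℝ} {s : Set ℝ}
    {t : ℝ} : HasDerivWithinAt M M' s t ↔
      ∀ i j, HasDerivWithinAt (fun r => M r i j) (M' i j) s t := by
  exact hasDerivWithinAt_pi.trans (forall_congr' fun i => hasDerivWithinAt_pi)

theorem HasDerivWithinAt.continuousWithinAt_matrix {M : ℝ → Matrix m n ℝ} {M' : Matrix m n ℝ}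
    {s : Set ℝ} {t : ℝ} (hM : HasDerivWithinAt M M' s t) : ContinuousWithinAt M s t :=
  continuousWithinAt_pi.2 fun i => continuousWithinAt_pi.2 fun j =>
    (hasDerivWithinAt_matrix_iff.1 hM i j).continuousWithinAt

theorem HasDerivWithinAt.matrix_transpose [Fintype m] {M : ℝ → Matrix m n ℝ} {M' : Matrix m n ℝ}
    {s : Set ℝ} {t : ℝ} (hM : HasDerivWithinAt M M' s t) :
    HasDerivWithinAt (fun r => (M r)ᵀ) M'ᵀ s t :=
  hasDerivWithinAt_matrix_iff.2 fun i j => hasDerivWithinAt_matrix_iff.1 hM j i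

theorem HasDerivWithinAt.matrix_mul [Fintype m] {M : ℝ → Matrix l m ℝ} {N : ℝ → Matrix m n ℝ}
    {M' : Matrix l m ℝ} {N' : Matrix m n ℝ} {s : Set ℝ} {t : ℝ}
    (hM : HasDerivWithinAt M M' s t) (hN : HasDerivWithinAt N N' s t) :
    HasDerivWithinAt (fun r => M r * N r) (M' * N t + M t * N') s t := by
  rw [hasDerivWithinAt_matrix_iff] at *
  intro i j
  simp only [Matrix.mul_apply, Matrix.add_apply, ← Finset.sum_add_distrib]
  exact HasDerivWithinAt.fun_sum fun k _ => (hM i k).mul (hN k j)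

theorem HasDerivWithinAt.dotProduct_mulVec {M : ℝ → Matrix n n ℝ} {M' : Matrix n n ℝ}
    {s : Set ℝ} {t : ℝ} (hM : HasDerivWithinAt M M' s t) (x : n → ℝ) :
    HasDerivWithinAt (fun r => x ⬝ᵥ M r *ᵥ x) (x ⬝ᵥ M' *ᵥ x) s t := by
  rw [hasDerivWithinAt_matrix_iff] at hM
  simp only [dotProduct, mulVec]
  exact HasDerivWithinAt.fun_sum fun i _ =>
    (HasDerivWithinAt.fun_sum fun j _ => (hM i j).mul_const (x j)).const_mul (x i)

theorem HasDerivWithinAt.matrix_inv [DecidableEq n] {M : ℝ → Matrix n n ℝ} {M' : Matrix n n ℝ}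
    {s : Set ℝ} {t : ℝ} (hM : HasDerivWithinAt M M' s t) (hs : t ∈ s)
    (hu : ∀ r ∈ s, IsUnit (M r)) :
    HasDerivWithinAt (fun r => (M r)⁻¹) (-((M t)⁻¹ * M' * (M t)⁻¹)) s t := by
  have hdet : ∀ r ∈ s, IsUnit (M r).det := fun r hr => (isUnit_iff_isUnit_det _).1 (hu r hr)
  have hc : ContinuousWithinAt (fun r => (M r)⁻¹) s t := by
    have hMc := hM.continuousWithinAt_matrix
    have hd : ContinuousWithinAt (fun r => (M r).det) s t :=
      (continuous_id.matrix_det.tendsto (M t)).comp hMc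
    have ha : ContinuousWithinAt (fun r => (M r).adjugate) s t :=
      (continuous_id.matrix_adjugate.tendsto (M t)).comp hMc
    simp only [Matrix.inv_def, Ring.inverse_eq_inv']
    exact (hd.inv₀ (hdet t hs).ne_zero).smul ha
  replace hM := hasDerivWithinAt_iff_tendsto_slope.1 hM
  refine hasDerivWithinAt_iff_tendsto_slope.2 ?_
  have hlim : Tendsto (fun r => -((M r)⁻¹ * slope M t r * (M t)⁻¹)) (𝓝[s \ {t}] t)
      (𝓝 (-((M t)⁻¹ * M' * (M t)⁻¹))) :=
    (((hc.tendsto.mono_left (nhdsWithin_mono _ sdiff_subset)).mul hM).mul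
      tendsto_const_nhds).neg
  refine hlim.congr' ?_
  filter_upwards [self_mem_nhdsWithin] with r hr
  simp only [slope, vsub_eq_sub, Matrix.mul_smul, Matrix.smul_mul, Matrix.mul_sub,
    Matrix.sub_mul, nonsing_inv_mul _ (hdet r hr.1), mul_nonsing_inv_cancel_right _ _ (hdet t hs),
    Matrix.one_mul, ← smul_neg, neg_sub]

end MatrixCalculus

section QuadraticForm

variable {l m n : Type*} [Fintype n]

theorem posSemidef_sub_smul_one_iff [DecidableEq n] {M : Matrix n n ℝ} (hM : M.IsSymm) {p : ℝ} :
    (M - p • (1 : Matrix n n ℝ)).PosSemidef ↔ ∀ x, p * (x ⬝ᵥ x) ≤ x ⬝ᵥ M *ᵥ x := by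
  have hH : (M - p • (1 : Matrix n n ℝ)).IsHermitian := by
    simp [Matrix.IsHermitian, conjTranspose_eq_transpose_of_trivial, hM.eq]
  rw [posSemidef_iff_dotProduct_mulVec, and_iff_right hH]
  simp [sub_mulVec, smul_mulVec, dotProduct_sub]

theorem posSemidef_smul_one_sub_iff [DecidableEq n] {M : Matrix n n ℝ} (hM : M.IsSymm) {p : ℝ} :
    (p • (1 : Matrix n n ℝ) - M).PosSemidef ↔ ∀ x, x ⬝ᵥ M *ᵥ x ≤ p * (x ⬝ᵥ x) := by
  have hH : (p • (1 : Matrix n n ℝ) - M).IsHermitian := by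
    simp [Matrix.IsHermitian, conjTranspose_eq_transpose_of_trivial, hM.eq]
  rw [posSemidef_iff_dotProduct_mulVec, and_iff_right hH]
  simp [sub_mulVec, smul_mulVec, dotProduct_sub]

theorem abs_dotProduct_mulVec_le {M : Matrix n n ℝ} {c : ℝ} (hM : ∀ i j, |M i j| ≤ c)
    (x : n → ℝ) : |x ⬝ᵥ M *ᵥ x| ≤ Fintype.card n * c * (x ⬝ᵥ x) := by
  have hterm : ∀ i j, |x i * (M i j * x j)| ≤ c * ((x i * x i + x j * x j) / 2) := by
    intro i j
    have h₁ := mul_le_mul_of_nonneg_right (hM i j)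
      (mul_nonneg (abs_nonneg (x i)) (abs_nonneg (x j)))
    have h₂ := mul_le_mul_of_nonneg_left (two_mul_le_add_sq |x i| |x j|)
      ((abs_nonneg _).trans (hM i j))
    rw [sq_abs, sq_abs] at h₂
    rw [abs_mul, abs_mul]
    nlinarith
  calc |x ⬝ᵥ M *ᵥ x| = |∑ i, ∑ j, x i * (M i j * x j)| := by
        simp only [dotProduct, mulVec, Finset.mul_sum]
    _ ≤ ∑ i, ∑ j, c * ((x i * x i + x j * x j) / 2) :=
        (Finset.abs_sum_le_sum_abs _ _).trans <| Finset.sum_le_sum fun i _ =>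
          (Finset.abs_sum_le_sum_abs _ _).trans <| Finset.sum_le_sum fun j _ => hterm i j
    _ = Fintype.card n * c * (x ⬝ᵥ x) := by
        simp only [← Finset.mul_sum, ← Finset.sum_div, Finset.sum_add_distrib, Finset.sum_const,
          Finset.card_univ, nsmul_eq_mul, dotProduct]
        rw [show ∑ i, x i * (Fintype.card n * x i) = Fintype.card n * ∑ i, x i * x i by
          rw [Finset.mul_sum]; exact Finset.sum_congr rfl fun _ _ => by ring]
        ring

theorem abs_matrix_mul_apply_le {M : Matrix l n ℝ} {N : Matrix n m ℝ} {a b : ℝ}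
    (hM : ∀ i j, |M i j| ≤ a) (hN : ∀ i j, |N i j| ≤ b) (i : l) (j : m) :
    |(M * N) i j| ≤ Fintype.card n * (a * b) := by
  rw [Matrix.mul_apply]
  refine (Finset.abs_sum_le_sum_abs _ _).trans ?_
  refine (Finset.sum_le_card_nsmul _ _ (a * b) fun k _ => ?_).trans_eq (by simp)
  rw [abs_mul]
  exact mul_le_mul (hM i k) (hN k j) (abs_nonneg _) ((abs_nonneg _).trans (hM i k))

theorem dotProduct_transpose_mulVec_self (M : Matrix n n ℝ) (x : n → ℝ) :
    x ⬝ᵥ Mᵀ *ᵥ x = x ⬝ᵥ M *ᵥ x := by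
  rw [mulVec_transpose, dotProduct_comm, ← dotProduct_mulVec]

theorem dotProduct_transpose_mul_mul_mulVec [Fintype m] (M : Matrix n n ℝ) (N : Matrix n m ℝ)
    (x : m → ℝ) :
    x ⬝ᵥ (Nᵀ * M * N) *ᵥ x = (N *ᵥ x) ⬝ᵥ M *ᵥ (N *ᵥ x) := by
  rw [← mulVec_mulVec, ← mulVec_mulVec, dotProduct_mulVec, vecMul_transpose]

theorem mul_dotProduct_le_of_forall_sphere {M : Matrix n n ℝ} {p : ℝ}
    (h : ∀ x ∈ Metric.sphere (0 : n → ℝ) 1, p * (x ⬝ᵥ x) ≤ x ⬝ᵥ M *ᵥ x) (x : n → ℝ) :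
    p * (x ⬝ᵥ x) ≤ x ⬝ᵥ M *ᵥ x := by
  rcases eq_or_ne x 0 with rfl | hx
  · simp
  have hx' : 0 < ‖x‖ := norm_pos_iff.2 hx
  have := h (‖x‖⁻¹ • x) (by simp [norm_smul, hx'.ne'])
  simp only [mulVec_smul, dotProduct_smul, smul_dotProduct, smul_eq_mul] at this
  have h₁ := mul_le_mul_of_nonneg_left this (mul_pos hx' hx').le
  field_simp at h₁
  linarith

theorem Matrix.PosDef.exists_pos_forall_sphere [Nonempty n] {M : Matrix n n ℝ} (hM : M.PosDef) :
    ∃ p > 0, ∀ x ∈ Metric.sphere (0 : n → ℝ) 1, p < x ⬝ᵥ M *ᵥ x := by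
  have hcont : Continuous fun x : n → ℝ => x ⬝ᵥ M *ᵥ x := by fun_prop
  obtain ⟨y, hy, hmin⟩ := (isCompact_sphere (0 : n → ℝ) 1).exists_isMinOn
    (NormedSpace.sphere_nonempty.2 zero_le_one) hcont.continuousOn
  have hpos : 0 < y ⬝ᵥ M *ᵥ y := by
    have := hM.dotProduct_mulVec_pos (x := y) (by rintro rfl; simp at hy)
    simpa using this
  exact ⟨(y ⬝ᵥ M *ᵥ y) / 2, half_pos hpos, fun x hx => (half_lt_self hpos).trans_le (hmin hx)⟩

theorem dotProduct_self_le_of_mem_sphere {x : n → ℝ} (hx : x ∈ Metric.sphere (0 : n → ℝ) 1) :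
    x ⬝ᵥ x ≤ Fintype.card n := by
  refine (Finset.sum_le_card_nsmul _ _ 1 fun i _ => ?_).trans_eq (by simp)
  have h : |x i| ≤ 1 := (norm_le_pi_norm x i).trans_eq (by simpa using hx)
  rw [← abs_mul_abs_self]
  exact mul_le_one₀ h (abs_nonneg _) h

theorem dotProduct_mulVec_le_of_le_inv [DecidableEq n] {P : Matrix n n ℝ} (hu : IsUnit P)
    {κ : ℝ} (hκ : 0 < κ) (h : ∀ x, κ * (x ⬝ᵥ x) ≤ x ⬝ᵥ P⁻¹ *ᵥ x) (y : n → ℝ) :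
    y ⬝ᵥ P *ᵥ y ≤ κ⁻¹ * (y ⬝ᵥ y) := by
  have h₁ := h (P *ᵥ y)
  rw [mulVec_mulVec, nonsing_inv_mul _ ((isUnit_iff_isUnit_det _).1 hu), one_mulVec,
    dotProduct_comm (P *ᵥ y) y] at h₁
  have h₂ := dotProduct_self_star_nonneg (κ • P *ᵥ y - y)
  simp only [star_trivial, dotProduct_sub, sub_dotProduct, dotProduct_smul, smul_dotProduct,
    smul_eq_mul, dotProduct_comm (P *ᵥ y) y] at h₂
  rw [inv_mul_eq_div, le_div_iff₀ hκ]
  nlinarith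

end QuadraticForm

theorem integral_exp_mul_le_of_hasDerivWithinAt {g g' h : ℝ → ℝ} {t T k : ℝ} (htT : t ≤ T)
    (hg : ∀ r ∈ Icc t T, HasDerivWithinAt g (g' r) (Ici t) r) (hh : ContinuousOn h (Icc t T))
    (hgh : ∀ r ∈ Icc t T, h r ≤ g' r + k * g r) :
    ∫ r in t..T, Real.exp (k * (r - t)) * h r ≤ Real.exp (k * (T - t)) * g T - g t := by
  have hexp : ∀ r, HasDerivAt (fun r => Real.exp (k * (r - t))) (Real.exp (k * (r - t)) * k) r :=
    fun r => by simpa using (((hasDerivAt_id r).sub_const t).const_mul k).exp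
  have hd : ∀ r ∈ Icc t T, HasDerivWithinAt (fun r => Real.exp (k * (r - t)) * g r)
      (Real.exp (k * (r - t)) * k * g r + Real.exp (k * (r - t)) * g' r) (Ici t) r :=
    fun r hr => (hexp r).hasDerivWithinAt.mul (hg r hr)
  have := intervalIntegral.integral_le_sub_of_hasDeriv_right_of_le
    (φ := fun r => Real.exp (k * (r - t)) * h r) htT
    (fun r hr => (hd r hr).continuousWithinAt.mono Icc_subset_Ici_self)
    (fun r hr => (hd r (Ioo_subset_Icc_self hr)).mono
      ((Ioi_subset_Ioi hr.1.le).trans Ioi_subset_Ici_self))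
    (ContinuousOn.integrableOn_Icc (by fun_prop))
    (fun r hr => by
      have := mul_le_mul_of_nonneg_left (hgh r (Ioo_subset_Icc_self hr))
        (Real.exp_pos (k * (r - t))).le
      linarith)
  simpa using this

section Riccati

variable {n : Type*} [Fintype n] {A V S P : ℝ → Matrix n n ℝ} {a s ε : ℝ}

theorem riccati_exists_lower_bound [Nonempty n] [DecidableEq n] (ha : 0 ≤ a) (hs : 0 ≤ s)
    (hε : 0 < ε)
    (hA : ∀ t, 0 ≤ t → ∀ x, |x ⬝ᵥ A t *ᵥ x| ≤ a * (x ⬝ᵥ x))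
    (hS : ∀ t, 0 ≤ t → ∀ x, x ⬝ᵥ S t *ᵥ x ≤ s * (x ⬝ᵥ x))
    (hV : ∀ t, 0 ≤ t → ∀ x, ε * (x ⬝ᵥ x) ≤ x ⬝ᵥ V t *ᵥ x)
    (hPsymm : ∀ t, 0 ≤ t → (P t).IsSymm) (hP₀ : (P 0).PosDef)
    (hP' : ∀ t, 0 ≤ t → HasDerivWithinAt P
      (A t * P t + P t * (A t)ᵀ - P t * S t * P t + V t) (Ici 0) t) :
    ∃ p > 0, ∀ t, 0 ≤ t → ∀ x, p * (x ⬝ᵥ x) ≤ x ⬝ᵥ P t *ᵥ x := by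
  obtain ⟨q, hq, hqP⟩ := hP₀.exists_pos_forall_sphere
  have hcard : (0 : ℝ) < Fintype.card n := by exact_mod_cast Fintype.card_pos
  obtain ⟨p, hp, hp1, hpε, hpq⟩ :
      ∃ p > 0, p ≤ 1 ∧ p * (2 * a + s) < ε ∧ p * Fintype.card n ≤ q := by
    have hd : 0 < 2 * a + s + 1 := by linarith
    refine ⟨min 1 (min (ε / (2 * a + s + 1)) (q / Fintype.card n)), by positivity,
      min_le_left _ _, ?_, ?_⟩
    · have h₁ : 0 < min 1 (min (ε / (2 * a + s + 1)) (q / Fintype.card n)) := by positivity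
      have h₂ : min 1 (min (ε / (2 * a + s + 1)) (q / Fintype.card n)) ≤ ε / (2 * a + s + 1) :=
        (min_le_right _ _).trans (min_le_left _ _)
      rw [le_div_iff₀ hd] at h₂
      linarith
    · exact (le_div_iff₀ hcard).1 ((min_le_right _ _).trans (min_le_right _ _))
  refine ⟨p, hp, fun T hT => mul_dotProduct_le_of_forall_sphere fun y hy => ?_⟩
  by_contra! hlt
  let f : ℝ × (n → ℝ) → ℝ := fun z => z.2 ⬝ᵥ P z.1 *ᵥ z.2 - p * (z.2 ⬝ᵥ z.2)
  have hPc : ContinuousOn P (Ici 0) := fun t ht => (hP' t ht).continuousWithinAt_matrix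
  have hf : ContinuousOn f (Icc 0 T ×ˢ Metric.sphere 0 1) := by
    have hP₁ : ContinuousOn (fun z : ℝ × (n → ℝ) => P z.1) (Icc 0 T ×ˢ Metric.sphere 0 1) :=
      hPc.comp continuousOn_fst fun z hz => hz.1.1
    have hq : Continuous fun z : Matrix n n ℝ × (n → ℝ) =>
        z.2 ⬝ᵥ z.1 *ᵥ z.2 - p * (z.2 ⬝ᵥ z.2) := by fun_prop
    exact hq.comp_continuousOn (hP₁.prodMk continuousOn_snd)
  have hK : IsCompact (Icc 0 T ×ˢ Metric.sphere (0 : n → ℝ) 1) :=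
    isCompact_Icc.prod (isCompact_sphere _ _)
  have hZ : IsCompact ((Icc 0 T ×ˢ Metric.sphere (0 : n → ℝ) 1) ∩ f ⁻¹' Iic 0) :=
    hK.of_isClosed_subset (hf.preimage_isClosed_of_isClosed hK.isClosed isClosed_Iic)
      inter_subset_left
  obtain ⟨⟨t, x⟩, ⟨⟨⟨ht, htT⟩, hx⟩, hfx⟩, hmin⟩ := hZ.exists_isMinOn
    ⟨(T, y), ⟨⟨hT, le_rfl⟩, hy⟩, by simpa [f] using hlt.le⟩ continuousOn_fst
  have hbefore : ∀ r ∈ Ico 0 t, ∀ z ∈ Metric.sphere (0 : n → ℝ) 1, 0 < f (r, z) := by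
    intro r hr z hz
    by_contra! hle
    exact hr.2.not_ge (hmin (a := (r, z)) ⟨⟨⟨hr.1, hr.2.le.trans htT⟩, hz⟩, hle⟩)
  have ht₀ : 0 < t := by
    refine ht.lt_of_ne ?_
    rintro rfl
    have h₁ := hqP x hx
    have h₂ := mul_le_mul_of_nonneg_left (dotProduct_self_le_of_mem_sphere hx) hp.le
    have h₃ : f (0, x) ≤ 0 := hfx
    simp only [f] at h₃
    linarith
  have hfd : ∀ z, HasDerivAt (fun r => f (r, z))
      (z ⬝ᵥ (A t * P t + P t * (A t)ᵀ - P t * S t * P t + V t) *ᵥ z) t := fun z => by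
    simpa only [f] using (((hP' t ht).dotProduct_mulVec z).hasDerivAt (Ici_mem_nhds ht₀)).sub_const
      (p * (z ⬝ᵥ z))
  have hIoo : ∀ᶠ r in 𝓝[<] t, r ∈ Ioo 0 t := Ioo_mem_nhdsLT ht₀
  have hnonneg : ∀ z, p * (z ⬝ᵥ z) ≤ z ⬝ᵥ P t *ᵥ z := by
    refine mul_dotProduct_le_of_forall_sphere fun z hz => sub_nonneg.1 ?_
    refine ge_of_tendsto ((hfd z).continuousAt.tendsto.mono_left (nhdsWithin_le_nhds (s := Iio t)))
      ?_
    filter_upwards [hIoo] with r hr using (hbefore r (Ioo_subset_Ico_self hr) z hz).le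
  have hfx₀ : f (t, x) = 0 := le_antisymm hfx (sub_nonneg.2 (hnonneg x))
  have heig : P t *ᵥ x = p • x := by
    have hpsd := (posSemidef_sub_smul_one_iff (hPsymm t ht)).2 hnonneg
    have := (hpsd.dotProduct_mulVec_zero_iff x).1 (by
      simpa [f, sub_mulVec, smul_mulVec, dotProduct_sub] using hfx₀)
    simpa [sub_mulVec, smul_mulVec, sub_eq_zero] using this
  have hderiv : x ⬝ᵥ (A t * P t + P t * (A t)ᵀ - P t * S t * P t + V t) *ᵥ x =
      2 * p * (x ⬝ᵥ A t *ᵥ x) - p ^ 2 * (x ⬝ᵥ S t *ᵥ x) + x ⬝ᵥ V t *ᵥ x := by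
    have hleft : ∀ z, x ⬝ᵥ P t *ᵥ z = p * (x ⬝ᵥ z) := fun z => by
      rw [dotProduct_mulVec, ← mulVec_transpose, (hPsymm t ht).eq, heig, smul_dotProduct,
        smul_eq_mul]
    simp only [add_mulVec, sub_mulVec, ← mulVec_mulVec, dotProduct_add, dotProduct_sub, hleft,
      heig, mulVec_smul, dotProduct_smul, smul_eq_mul,
      dotProduct_transpose_mulVec_self]
    ring
  have hpos : 0 < x ⬝ᵥ (A t * P t + P t * (A t)ᵀ - P t * S t * P t + V t) *ᵥ x := by
    have hxx : 0 < x ⬝ᵥ x := by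
      simpa using dotProduct_self_star_pos_iff.2 (show x ≠ 0 by rintro rfl; simp at hx)
    have h₁ := mul_le_mul_of_nonneg_left (neg_le_of_abs_le (hA t ht x)) (by positivity : 0 ≤ 2 * p)
    have h₂ := mul_le_mul_of_nonneg_left (hS t ht x) (by positivity : 0 ≤ p ^ 2)
    have h₃ : p ^ 2 * (s * (x ⬝ᵥ x)) ≤ p * (s * (x ⬝ᵥ x)) :=
      mul_le_mul_of_nonneg_right (by nlinarith) (by positivity)
    have h₄ := mul_lt_mul_of_pos_right hpε hxx
    rw [hderiv]
    linarith [hV t ht x]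
  have hslope := (hasDerivAt_iff_tendsto_slope.1 (hfd x)).mono_left
    (nhdsWithin_mono (s := Iio t) t fun r hr => ne_of_lt hr)
  refine hpos.not_ge (le_of_tendsto hslope ?_)
  filter_upwards [hIoo] with r hr
  rw [slope_def_field, hfx₀, sub_zero]
  exact div_nonpos_of_nonneg_of_nonpos (hbefore r (Ioo_subset_Ico_self hr) x hx).le
    (sub_nonpos.2 hr.2.le)

theorem dotProduct_mulVec_integral {M : ℝ → Matrix n n ℝ} {t T : ℝ} (htT : t ≤ T)
    (hM : ContinuousOn M (Icc t T)) (w : n → ℝ) :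
    w ⬝ᵥ (Matrix.of fun i j => ∫ r in t..T, M r i j) *ᵥ w = ∫ r in t..T, w ⬝ᵥ M r *ᵥ w := by
  have hij : ∀ i j, ContinuousOn (fun r => M r i j * w j) (Icc t T) := fun i j =>
    ContinuousOn.mul_const (by fun_prop) _
  have hi : ∀ i, ContinuousOn (fun r => w i * ∑ j, M r i j * w j) (Icc t T) := fun i =>
    continuousOn_const.mul (continuousOn_finsetSum _ fun j _ => hij i j)
  simp only [dotProduct, mulVec, of_apply]
  rw [intervalIntegral.integral_finsetSum fun i _ => (hi i).intervalIntegrable_of_Icc htT]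
  refine Finset.sum_congr rfl fun i _ => ?_
  rw [intervalIntegral.integral_const_mul,
    intervalIntegral.integral_finsetSum fun j _ => (hij i j).intervalIntegrable_of_Icc htT]
  simp only [intervalIntegral.integral_mul_const]

theorem dotProduct_self_transition_le {F : ℝ → Matrix n n ℝ} {t T : ℝ} (htT : t ≤ T)
    [DecidableEq n] (hFt : F t = 1)
    (hA : ∀ r ∈ Icc t T, ∀ x, |x ⬝ᵥ A r *ᵥ x| ≤ a * (x ⬝ᵥ x))
    (hF : ∀ r ∈ Icc t T, HasDerivWithinAt F (A r * F r) (Ici t) r) (w : n → ℝ) :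
    (F T *ᵥ w) ⬝ᵥ (F T *ᵥ w) ≤ Real.exp (2 * a * (T - t)) * (w ⬝ᵥ w) := by
  have hquad : ∀ r, w ⬝ᵥ ((F r)ᵀ * F r) *ᵥ w = (F r *ᵥ w) ⬝ᵥ (F r *ᵥ w) := fun r => by
    rw [← mulVec_mulVec, dotProduct_mulVec, vecMul_transpose]
  have hd : ∀ r ∈ Icc t T, HasDerivWithinAt (fun r => -(w ⬝ᵥ ((F r)ᵀ * F r) *ᵥ w))
      (-(2 * ((F r *ᵥ w) ⬝ᵥ A r *ᵥ (F r *ᵥ w)))) (Ici t) r := fun r hr => by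
    refine HasDerivWithinAt.congr_deriv
      (((hF r hr).matrix_transpose.matrix_mul (hF r hr)).dotProduct_mulVec w).fun_neg ?_
    rw [add_mulVec, dotProduct_add, transpose_mul, ← Matrix.mul_assoc,
      dotProduct_transpose_mul_mul_mulVec, dotProduct_transpose_mul_mul_mulVec,
      dotProduct_transpose_mulVec_self, two_mul]
  have := integral_exp_mul_le_of_hasDerivWithinAt (h := fun _ => 0) (k := -(2 * a)) htT hd
    continuousOn_const (fun r hr => by
      have := le_of_abs_le (hA r hr (F r *ᵥ w))
      rw [hquad]
      linarith)
  simp only [mul_zero, intervalIntegral.integral_zero] at this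
  rw [hquad, hquad, hFt, one_mulVec, neg_mul, Real.exp_neg, mul_neg, sub_neg_eq_add,
    neg_add_eq_sub, sub_nonneg, inv_mul_le_iff₀ (Real.exp_pos _)] at this
  exact this

theorem integral_le_exp_mul_riccati_inv [DecidableEq n] {F : ℝ → Matrix n n ℝ} {t T p v : ℝ}
    (htT : t ≤ T) (hp : 0 < p) (hv : 0 ≤ v)
    (hSc : ContinuousOn S (Icc t T))
    (hS : ∀ r ∈ Icc t T, ∀ x, 0 ≤ x ⬝ᵥ S r *ᵥ x)
    (hV : ∀ r ∈ Icc t T, ∀ x, x ⬝ᵥ V r *ᵥ x ≤ v * (x ⬝ᵥ x))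
    (hPsymm : ∀ r ∈ Ici t, (P r).IsSymm) (hPu : ∀ r ∈ Ici t, IsUnit (P r))
    (hPp : ∀ r ∈ Ici t, ∀ x, p * (x ⬝ᵥ x) ≤ x ⬝ᵥ P r *ᵥ x)
    (hP' : ∀ r ∈ Icc t T, HasDerivWithinAt P
      (A r * P r + P r * (A r)ᵀ - P r * S r * P r + V r) (Ici t) r)
    (hF : ∀ r ∈ Icc t T, HasDerivWithinAt F (A r * F r) (Ici t) r) (w : n → ℝ) :
    ∫ r in t..T, w ⬝ᵥ ((F r)ᵀ * S r * F r) *ᵥ w ≤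
      Real.exp (v / p * (T - t)) * ((F T *ᵥ w) ⬝ᵥ (P T)⁻¹ *ᵥ (F T *ᵥ w)) := by
  have hFc : ContinuousOn F (Icc t T) := fun r hr =>
    (hF r hr).continuousWithinAt_matrix.mono Icc_subset_Ici_self
  have hPinv : ∀ r ∈ Ici t, ∀ x,
      p * (((P r)⁻¹ *ᵥ x) ⬝ᵥ ((P r)⁻¹ *ᵥ x)) ≤ x ⬝ᵥ (P r)⁻¹ *ᵥ x := fun r hr x => by
    have := hPp r hr ((P r)⁻¹ *ᵥ x)
    rwa [mulVec_mulVec, mul_nonsing_inv _ ((isUnit_iff_isUnit_det _).1 (hPu r hr)), one_mulVec,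
      dotProduct_comm _ x] at this
  have hhc : ContinuousOn (fun r => w ⬝ᵥ ((F r)ᵀ * S r * F r) *ᵥ w) (Icc t T) := by fun_prop
  have hh : ∀ r ∈ Icc t T, 0 ≤ w ⬝ᵥ ((F r)ᵀ * S r * F r) *ᵥ w := fun r hr => by
    rw [dotProduct_transpose_mul_mul_mulVec]; exact hS r hr _
  have hd : ∀ r ∈ Icc t T, HasDerivWithinAt (fun r => w ⬝ᵥ ((F r)ᵀ * (P r)⁻¹ * F r) *ᵥ w)
      (w ⬝ᵥ ((F r)ᵀ * S r * F r) *ᵥ w -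
        ((P r)⁻¹ *ᵥ F r *ᵥ w) ⬝ᵥ V r *ᵥ ((P r)⁻¹ *ᵥ F r *ᵥ w)) (Ici t) r := fun r hr => by
    refine (((hF r hr).matrix_transpose.matrix_mul
      ((hP' r hr).matrix_inv hr.1 hPu)).matrix_mul (hF r hr)).dotProduct_mulVec w |>.congr_deriv ?_
    have hdet := (isUnit_iff_isUnit_det _).1 (hPu r hr.1)
    have hWsymm : ((P r)⁻¹)ᵀ = (P r)⁻¹ := by rw [transpose_nonsing_inv, (hPsymm r hr.1).eq]
    have hW : (P r)⁻¹ * (A r * P r + P r * (A r)ᵀ - P r * S r * P r + V r) * (P r)⁻¹ =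
        (P r)⁻¹ * A r + (A r)ᵀ * (P r)⁻¹ - S r + ((P r)⁻¹)ᵀ * V r * (P r)⁻¹ := by
      rw [hWsymm]
      simp only [Matrix.mul_add, Matrix.add_mul, Matrix.mul_sub, Matrix.sub_mul, Matrix.mul_assoc,
        mul_nonsing_inv _ hdet, Matrix.mul_one, nonsing_inv_mul_cancel_left _ _ hdet]
    rw [← dotProduct_transpose_mul_mul_mulVec, ← dotProduct_transpose_mul_mul_mulVec,
      ← dotProduct_sub, ← sub_mulVec, hW]
    congr 2
    simp only [transpose_mul]
    noncomm_ring
  have hmain := integral_exp_mul_le_of_hasDerivWithinAt (k := v / p) htT hd hhc fun r hr => by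
    have h₁ := hV r hr ((P r)⁻¹ *ᵥ F r *ᵥ w)
    have h₂ := mul_le_mul_of_nonneg_left (hPinv r hr.1 (F r *ᵥ w)) (div_nonneg hv hp.le)
    rw [← mul_assoc, div_mul_cancel₀ _ hp.ne'] at h₂
    rw [dotProduct_transpose_mul_mul_mulVec (P r)⁻¹]
    linarith
  have hmono : ∫ r in t..T, w ⬝ᵥ ((F r)ᵀ * S r * F r) *ᵥ w ≤
      ∫ r in t..T, Real.exp (v / p * (r - t)) * (w ⬝ᵥ ((F r)ᵀ * S r * F r) *ᵥ w) := by
    refine intervalIntegral.integral_mono_on htT (hhc.intervalIntegrable_of_Icc htT)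
      (ContinuousOn.intervalIntegrable_of_Icc htT (by fun_prop)) fun r hr => ?_
    exact le_mul_of_one_le_left (hh r hr)
      (Real.one_le_exp (mul_nonneg (div_nonneg hv hp.le) (sub_nonneg.2 hr.1)))
  rw [dotProduct_transpose_mul_mul_mulVec, dotProduct_transpose_mul_mul_mulVec] at hmain
  have hinit : 0 ≤ (F t *ᵥ w) ⬝ᵥ (P t)⁻¹ *ᵥ (F t *ᵥ w) :=
    (mul_nonneg hp.le (Finset.sum_nonneg fun i _ => mul_self_nonneg _)).trans
      (hPinv t self_mem_Ici (F t *ᵥ w))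
  linarith

end Riccati

/-- Boundedness of the solution of the continuous Riccati equation
`Ṗ = A P + P Aᵀ − P Cᵀ Q C P + V` under the Gramian conditions of Bucy:
if `A`, `C` are continuous and bounded on `[0,∞)`, `V`, `Q` are continuous, bounded,
symmetric and uniformly positive definite, `Φ` is the state transition matrix of `A`, and
the two Gramian lower bounds hold, then any symmetric solution `P` with `P(0)` positive
definite satisfies `p_m I ⪯ P(t) ⪯ p_M I` for some constants `0 < p_m ≤ p_M < ∞`. -/
theorem riccati_solution_bounded
    (n m : ℕ) (hn : 1 ≤ n) (hm : 1 ≤ m)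
    (A : ℝ → Matrix (Fin n) (Fin n) ℝ) (C : ℝ → Matrix (Fin m) (Fin n) ℝ)
    (V : ℝ → Matrix (Fin n) (Fin n) ℝ) (Q : ℝ → Matrix (Fin m) (Fin m) ℝ)
    (hAcont : ∀ i j, ContinuousOn (fun t => A t i j) (Set.Ici (0 : ℝ)))
    (hAbdd : ∃ c : ℝ, ∀ t : ℝ, 0 ≤ t → ∀ i j, |A t i j| ≤ c)
    (hCcont : ∀ i j, ContinuousOn (fun t => C t i j) (Set.Ici (0 : ℝ)))
    (hCbdd : ∃ c : ℝ, ∀ t : ℝ, 0 ≤ t → ∀ i j, |C t i j| ≤ c)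
    (hVcont : ∀ i j, ContinuousOn (fun t => V t i j) (Set.Ici (0 : ℝ)))
    (hVbdd : ∃ c : ℝ, ∀ t : ℝ, 0 ≤ t → ∀ i j, |V t i j| ≤ c)
    (hVsymm : ∀ t : ℝ, 0 ≤ t → (V t).IsSymm)
    (hVpos : ∃ ε > (0 : ℝ), ∀ t : ℝ, 0 ≤ t →
      (V t - ε • (1 : Matrix (Fin n) (Fin n) ℝ)).PosSemidef)
    (hQcont : ∀ i j, ContinuousOn (fun t => Q t i j) (Set.Ici (0 : ℝ)))
    (hQbdd : ∃ c : ℝ, ∀ t : ℝ, 0 ≤ t → ∀ i j, |Q t i j| ≤ c)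
    (hQsymm : ∀ t : ℝ, 0 ≤ t → (Q t).IsSymm)
    (hQpos : ∃ ε > (0 : ℝ), ∀ t : ℝ, 0 ≤ t →
      (Q t - ε • (1 : Matrix (Fin m) (Fin m) ℝ)).PosSemidef)
    (Φ : ℝ → ℝ → Matrix (Fin n) (Fin n) ℝ)
    (hΦ₀ : ∀ τ : ℝ, Φ τ τ = 1)
    (hΦ' : ∀ τ : ℝ, ∀ i j, ∀ t : ℝ,
      HasDerivAt (fun s => Φ s τ i j) ((A t * Φ t τ) i j) t)
    (δ μv μq : ℝ) (hδ : 0 < δ) (hμv : 0 < μv) (hμq : 0 < μq)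
    (hGramV : ∀ t : ℝ, 0 ≤ t →
      ((Matrix.of fun i j =>
          (1/δ) * ∫ τ in t..(t + δ), (Φ (t + δ) τ * V τ * (Φ (t + δ) τ)ᵀ) i j) -
        μv • (1 : Matrix (Fin n) (Fin n) ℝ)).PosSemidef)
    (hGramQ : ∀ t : ℝ, 0 ≤ t →
      ((Matrix.of fun i j =>
          (1/δ) * ∫ τ in t..(t + δ), ((Φ τ t)ᵀ * (C τ)ᵀ * Q τ * C τ * Φ τ t) i j) -
        μq • (1 : Matrix (Fin n) (Fin n) ℝ)).PosSemidef)
    (P : ℝ → Matrix (Fin n) (Fin n) ℝ)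
    (hPsymm : ∀ t : ℝ, 0 ≤ t → (P t).IsSymm)
    (hP₀ : (P 0).PosDef)
    (hP' : ∀ i j, ∀ t : ℝ, 0 ≤ t →
      HasDerivWithinAt (fun s => P s i j)
        ((A t * P t + P t * (A t)ᵀ - P t * (C t)ᵀ * Q t * C t * P t + V t) i j)
        (Set.Ici (0 : ℝ)) t) :
    ∃ pm pM : ℝ, 0 < pm ∧ pm ≤ pM ∧ ∀ t : ℝ, 0 ≤ t →
      (P t - pm • (1 : Matrix (Fin n) (Fin n) ℝ)).PosSemidef ∧
      (pM • (1 : Matrix (Fin n) (Fin n) ℝ) - P t).PosSemidef := by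
  have : Nonempty (Fin n) := ⟨⟨0, hn⟩⟩
  obtain ⟨cA, hcA⟩ := hAbdd
  obtain ⟨cC, hcC⟩ := hCbdd
  obtain ⟨cV, hcV⟩ := hVbdd
  obtain ⟨cQ, hcQ⟩ := hQbdd
  obtain ⟨εV, hεV, hVε⟩ := hVpos
  obtain ⟨εQ, hεQ, hQε⟩ := hQpos
  have hquad : ∀ {M : ℝ → Matrix (Fin n) (Fin n) ℝ} {c : ℝ},
      (∀ t, 0 ≤ t → ∀ i j, |M t i j| ≤ c) →
      ∃ b, 0 ≤ b ∧ ∀ t, 0 ≤ t → ∀ x, |x ⬝ᵥ M t *ᵥ x| ≤ b * (x ⬝ᵥ x) := by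
    intro M c hM
    refine ⟨Fintype.card (Fin n) * c, ?_, fun t ht => abs_dotProduct_mulVec_le (hM t ht)⟩
    exact mul_nonneg (Nat.cast_nonneg _) ((abs_nonneg _).trans (hM 0 le_rfl ⟨0, hn⟩ ⟨0, hn⟩))
  have hcont : ∀ {k l : ℕ} {M : ℝ → Matrix (Fin k) (Fin l) ℝ},
      (∀ i j, ContinuousOn (fun t => M t i j) (Ici 0)) → ContinuousOn M (Ici 0) := fun h =>
    continuousOn_pi.2 fun i => continuousOn_pi.2 (h i)
  let S : ℝ → Matrix (Fin n) (Fin n) ℝ := fun t => (C t)ᵀ * Q t * C t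
  have hSc : ContinuousOn S (Ici 0) := by
    have hC := hcont hCcont
    have hQ := hcont hQcont
    fun_prop
  have hS₀ : ∀ t, 0 ≤ t → ∀ x, 0 ≤ x ⬝ᵥ S t *ᵥ x := fun t ht x => by
    rw [dotProduct_transpose_mul_mul_mulVec]
    exact (mul_nonneg hεQ.le (Finset.sum_nonneg fun i _ => mul_self_nonneg _)).trans
      ((posSemidef_sub_smul_one_iff (hQsymm t ht)).1 (hQε t ht) _)
  obtain ⟨a, ha, hA⟩ := hquad hcA
  obtain ⟨v, hv, hV⟩ := hquad hcV
  obtain ⟨s, hs, hS⟩ := hquad (M := S) fun t ht => abs_matrix_mul_apply_le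
    (abs_matrix_mul_apply_le (M := (C t)ᵀ) (fun i j => hcC t ht j i) (hcQ t ht)) (hcC t ht)
  have hPd : ∀ t, 0 ≤ t → HasDerivWithinAt P
      (A t * P t + P t * (A t)ᵀ - P t * S t * P t + V t) (Ici 0) t := fun t ht => by
    refine hasDerivWithinAt_matrix_iff.2 fun i j => ?_
    simpa only [S, Matrix.mul_assoc] using hP' i j t ht
  obtain ⟨p, hp, hPp⟩ := riccati_exists_lower_bound ha hs hεV hA
    (fun t ht x => (le_abs_self _).trans (hS t ht x))
    (fun t ht => (posSemidef_sub_smul_one_iff (hVsymm t ht)).1 (hVε t ht)) hPsymm hP₀ hPd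
  have hPu : ∀ t, 0 ≤ t → IsUnit (P t) := fun t ht => by
    refine mulVec_injective_iff_isUnit.1 ((injective_iff_map_eq_zero (P t).mulVecLin).2
      fun x hx => ?_)
    have h := hPp t ht x
    rw [show P t *ᵥ x = 0 from hx, dotProduct_zero] at h
    exact dotProduct_self_eq_zero.1 (le_antisymm (nonpos_of_mul_nonpos_right h hp)
      (Finset.sum_nonneg fun i _ => mul_self_nonneg _))
  let κ := δ * μq / (Real.exp (v / p * δ) * Real.exp (2 * a * δ))
  have hκ : 0 < κ := by positivity
  have hupper : ∀ t, 0 ≤ t → ∀ x, x ⬝ᵥ P (t + δ) *ᵥ x ≤ κ⁻¹ * (x ⬝ᵥ x) := by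
    intro t ht
    have htδ : t ≤ t + δ := by linarith
    have hsub : Ici t ⊆ Ici 0 := Ici_subset_Ici.2 ht
    have hF : ∀ r, HasDerivWithinAt (fun r => Φ r t) (A r * Φ r t) (Ici t) r := fun r =>
      hasDerivWithinAt_matrix_iff.2 fun i j => (hΦ' t i j r).hasDerivWithinAt
    have hFc : ContinuousOn (fun r => Φ r t) (Icc t (t + δ)) := fun r _ =>
      (hF r).continuousWithinAt_matrix.mono Icc_subset_Ici_self
    have hSc' : ContinuousOn S (Icc t (t + δ)) := hSc.mono (Icc_subset_Ici_self.trans hsub)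
    have hgrowth := dotProduct_self_transition_le (F := fun r => Φ r t) htδ (hΦ₀ t)
      (fun r hr => hA r (ht.trans hr.1)) (fun r _ => hF r)
    have hinfo := integral_le_exp_mul_riccati_inv htδ hp hv hSc'
      (fun r hr => hS₀ r (ht.trans hr.1))
      (fun r hr x => (le_abs_self _).trans (hV r (ht.trans hr.1) x))
      (fun r hr => hPsymm r (hsub hr)) (fun r hr => hPu r (hsub hr))
      (fun r hr => hPp r (hsub hr)) (fun r hr => hasDerivWithinAt_matrix_iff.2 fun i j =>
        (hasDerivWithinAt_matrix_iff.1 (hPd r (ht.trans hr.1)) i j).mono hsub)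
      (F := fun r => Φ r t) (fun r _ => hF r)
    have hgram : ∀ w, δ * μq * (w ⬝ᵥ w) ≤
        ∫ r in t..t + δ, w ⬝ᵥ ((Φ r t)ᵀ * S r * Φ r t) *ᵥ w := fun w => by
      have h := (hGramQ t ht).dotProduct_mulVec_nonneg w
      rw [← dotProduct_mulVec_integral htδ (by fun_prop)]
      have heq : (Matrix.of fun i j => (1 / δ) * ∫ τ in t..(t + δ),
          ((Φ τ t)ᵀ * (C τ)ᵀ * Q τ * C τ * Φ τ t) i j) = (1 / δ) • (Matrix.of fun i j =>
            ∫ r in t..t + δ, ((Φ r t)ᵀ * S r * Φ r t) i j) := by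
        ext i j
        simp [S, Matrix.mul_assoc]
      rw [heq, star_trivial, sub_mulVec, smul_mulVec, smul_mulVec, one_mulVec, dotProduct_sub,
        dotProduct_smul, dotProduct_smul, smul_eq_mul, smul_eq_mul, sub_nonneg, one_div_mul_eq_div,
        le_div_iff₀ hδ] at h
      linarith
    simp only [add_sub_cancel_left] at hgrowth hinfo
    have hbound : ∀ w, κ * ((Φ (t + δ) t *ᵥ w) ⬝ᵥ (Φ (t + δ) t *ᵥ w)) ≤
        (Φ (t + δ) t *ᵥ w) ⬝ᵥ (P (t + δ))⁻¹ *ᵥ (Φ (t + δ) t *ᵥ w) := fun w => by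
      have h₁ := (hgram w).trans (hinfo w)
      have h₂ := mul_le_mul_of_nonneg_left (hgrowth w) hκ.le
      have h₃ : κ * (Real.exp (2 * a * δ) * (w ⬝ᵥ w)) =
          δ * μq * (w ⬝ᵥ w) / Real.exp (v / p * δ) := by
        simp only [κ]
        field_simp
      rw [h₃] at h₂
      exact h₂.trans ((div_le_iff₀' (Real.exp_pos _)).2 h₁)
    have hsurj : Function.Surjective (Φ (t + δ) t).mulVec := by
      refine mulVec_surjective_iff_isUnit.2 (mulVec_injective_iff_isUnit.1
        ((injective_iff_map_eq_zero (Φ (t + δ) t).mulVecLin).2 fun w hw => ?_))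
      have h := (hgram w).trans (hinfo w)
      rw [show Φ (t + δ) t *ᵥ w = 0 from hw, zero_dotProduct, mul_zero] at h
      exact dotProduct_self_eq_zero.1 (le_antisymm (nonpos_of_mul_nonpos_right h (by positivity))
        (Finset.sum_nonneg fun i _ => mul_self_nonneg _))
    exact dotProduct_mulVec_le_of_le_inv (hPu _ (by linarith)) hκ
      (hsurj.forall.2 hbound)
  obtain ⟨K, hK⟩ : ∃ K, ∀ t ∈ Icc 0 δ, ∀ i j, |P t i j| ≤ K := by
    have hc : ∀ i j, ContinuousOn (fun t => P t i j) (Icc 0 δ) := fun i j t ht =>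
      (hP' i j t ht.1).continuousWithinAt.mono Icc_subset_Ici_self
    choose k hk using fun i j => isCompact_Icc.exists_bound_of_continuousOn (hc i j)
    refine ⟨∑ i, ∑ j, |k i j|, fun t ht i j => ((hk i j t ht).trans (le_abs_self _)).trans ?_⟩
    exact (Finset.single_le_sum (f := fun j => |k i j|) (fun _ _ => abs_nonneg _)
      (Finset.mem_univ j)).trans (Finset.single_le_sum (f := fun i => ∑ j, |k i j|)
        (fun _ _ => Finset.sum_nonneg fun _ _ => abs_nonneg _) (Finset.mem_univ i))
  refine ⟨p, max p (max κ⁻¹ (Fintype.card (Fin n) * K)), hp, le_max_left _ _, fun t ht =>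
    ⟨(posSemidef_sub_smul_one_iff (hPsymm t ht)).2 (hPp t ht),
      (posSemidef_smul_one_sub_iff (hPsymm t ht)).2 fun x => ?_⟩⟩
  have hxx : 0 ≤ x ⬝ᵥ x := Finset.sum_nonneg fun i _ => mul_self_nonneg _
  rcases le_total t δ with htδ | htδ
  · refine ((le_abs_self _).trans (abs_dotProduct_mulVec_le (hK t ⟨ht, htδ⟩) x)).trans ?_
    exact mul_le_mul_of_nonneg_right ((le_max_right _ _).trans (le_max_right _ _)) hxx
  · have h := hupper (t - δ) (sub_nonneg.2 htδ) x
    rw [sub_add_cancel] at h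
    exact h.trans (mul_le_mul_of_nonneg_right ((le_max_left _ _).trans (le_max_right _ _)) hxx)
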